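/- Let n ≥ 2 and s ≥ 1 be integers, let κ be a nonzero real number and b a real number. Define c_0 = 1 and, for 1 ≤ j ≤ n, c_j = Π_{l=0}^{j−1} ( 2(n + s − l)/κ ). Then ∫₀^b t^{n} J_{n+1+2s}(κt) dt = −Σ_{j=2}^{n} (c_{n−j}/κ) b^{j} J_{j+2s}(κb) − ( c_{n−1}/κ + c_n/(2s) ) · b J_{2s+1}(κb) − c_n Σ_{j=1}^{s−1} ( (2j+1)/(2j(j+1)) ) · b J_{2j+1}(κb) − (c_n/2) b J_1(κb) − (c_n/κ) J_0(κb) + c_n/κ. -/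

import Mathlib

open Real MeasureTheory

/-- Bessel function of the first kind of nonnegative integer order `m`. -/
noncomputable def besselJ (m : ℕ) (x : ℝ) : ℝ :=
  ∑' j : ℕ, ((-1 : ℝ) ^ j / ((j.factorial : ℝ) * ((j + m).factorial : ℝ))) * (x / 2) ^ (2 * j + m)

/-- The entire function with `J_m(x) = (x/2)^m * besselEntire m ((x/2)^2)`. -/
noncomputable def besselEntire (m : ℕ) (y : ℝ) : ℝ :=
  ∑' j : ℕ, ((-1 : ℝ) ^ j / ((j.factorial : ℝ) * ((j + m).factorial : ℝ))) * y ^ j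

lemma abs_besselEntire_coeff_le (m j : ℕ) :
    |(-1 : ℝ) ^ j / ((j.factorial : ℝ) * ((j + m).factorial : ℝ))| ≤ 1 / (j.factorial : ℝ) := by
  have h1 : (1 : ℝ) ≤ ((j + m).factorial : ℝ) := by
    exact_mod_cast Nat.one_le_iff_ne_zero.mpr (Nat.factorial_ne_zero _)
  have h0 : (0 : ℝ) < (j.factorial : ℝ) := by positivity
  rw [abs_div, abs_pow, abs_neg, abs_one, one_pow, abs_of_pos (by positivity)]
  exact one_div_le_one_div_of_le h0 (le_mul_of_one_le_right h0.le h1)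

lemma summable_besselEntire (m : ℕ) (y : ℝ) :
    Summable fun j : ℕ ↦
      ((-1 : ℝ) ^ j / ((j.factorial : ℝ) * ((j + m).factorial : ℝ))) * y ^ j := by
  refine Summable.of_norm_bounded (Real.summable_pow_div_factorial |y|) fun j ↦ ?_
  rw [Real.norm_eq_abs, abs_mul, abs_pow, div_eq_mul_one_div (|y| ^ j), mul_comm (|y| ^ j)]
  exact mul_le_mul_of_nonneg_right (abs_besselEntire_coeff_le m j) (by positivity)

lemma summable_natCast_mul_pow_pred_div_factorial (R : ℝ) :
    Summable fun j : ℕ ↦ 1 / (j.factorial : ℝ) * ((j : ℝ) * R ^ (j - 1)) := by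
  refine (summable_nat_add_iff 1).mp ((Real.summable_pow_div_factorial R).congr fun j ↦ ?_)
  have : (j.factorial : ℝ) ≠ 0 := by positivity
  rw [Nat.factorial_succ, Nat.add_sub_cancel]
  push_cast
  field_simp

lemma hasDerivAt_besselEntire (m : ℕ) (y : ℝ) :
    HasDerivAt (besselEntire m) (-besselEntire (m + 1) y) y := by
  have hmem : ∀ z : ℝ, |z| < |y| + 1 ↔ z ∈ Metric.ball (0 : ℝ) (|y| + 1) := fun z ↦ by simp
  have hy : y ∈ Metric.ball (0 : ℝ) (|y| + 1) := (hmem y).mp (by linarith)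
  have hbound : ∀ (j : ℕ) (z : ℝ), z ∈ Metric.ball (0 : ℝ) (|y| + 1) →
      ‖((-1 : ℝ) ^ j / ((j.factorial : ℝ) * ((j + m).factorial : ℝ))) * ((j : ℝ) * z ^ (j - 1))‖ ≤
        1 / (j.factorial : ℝ) * ((j : ℝ) * (|y| + 1) ^ (j - 1)) := by
    intro j z hz
    rw [Real.norm_eq_abs, abs_mul, abs_mul, abs_pow, Nat.abs_cast]
    have := abs_besselEntire_coeff_le m j
    have := ((hmem z).mpr hz).le
    gcongr
  have key := hasDerivAt_tsum_of_isPreconnected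
    (summable_natCast_mul_pow_pred_div_factorial (|y| + 1)) Metric.isOpen_ball
    (convex_ball (0 : ℝ) (|y| + 1)).isPreconnected
    (fun j z _ ↦ (hasDerivAt_pow j z).const_mul
      ((-1 : ℝ) ^ j / ((j.factorial : ℝ) * ((j + m).factorial : ℝ))))
    hbound hy (summable_besselEntire m y) hy
  have hsum : Summable fun j : ℕ ↦
      ((-1 : ℝ) ^ j / ((j.factorial : ℝ) * ((j + m).factorial : ℝ))) * ((j : ℝ) * y ^ (j - 1)) :=
    .of_norm_bounded (summable_natCast_mul_pow_pred_div_factorial (|y| + 1))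
      fun j ↦ hbound j y hy
  refine key.congr_deriv (Eq.symm ?_)
  rw [hsum.tsum_eq_zero_add, besselEntire, ← tsum_neg]
  simp only [Nat.cast_zero, zero_mul, mul_zero, zero_add]
  refine tsum_congr fun j ↦ ?_
  have : (j.factorial : ℝ) ≠ 0 := by positivity
  rw [Nat.factorial_succ j, Nat.add_sub_cancel, show j + 1 + m = j + (m + 1) by ring]
  push_cast
  field_simp
  ring

lemma besselEntire_recurrence (m : ℕ) (y : ℝ) :
    besselEntire m y = (m + 1) * besselEntire (m + 1) y - y * besselEntire (m + 2) y := by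
  have h1 := summable_besselEntire (m + 1) y
  have h2 := summable_besselEntire (m + 2) y
  have h0 := summable_besselEntire m y
  unfold besselEntire
  rw [h0.tsum_eq_zero_add, h1.tsum_eq_zero_add, mul_add, ← tsum_mul_left, ← tsum_mul_left,
    add_sub_assoc, ← (((summable_nat_add_iff 1).mpr h1).mul_left _).tsum_sub (h2.mul_left _)]
  congr 1
  · simp only [zero_add, Nat.factorial_succ m]
    have : (m.factorial : ℝ) ≠ 0 := by positivity
    push_cast
    field_simp
  · refine tsum_congr fun j ↦ ?_
    have : (j.factorial : ℝ) ≠ 0 := by positivity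
    have : ((j + m).factorial : ℝ) ≠ 0 := by positivity
    rw [show j + 1 + m = (j + m) + 1 by ring, show j + 1 + (m + 1) = (j + m) + 1 + 1 by ring,
      show j + (m + 2) = (j + m) + 1 + 1 by ring, Nat.factorial_succ (j + m + 1),
      Nat.factorial_succ (j + m), Nat.factorial_succ j]
    push_cast
    field_simp
    ring

lemma besselJ_eq_besselEntire (m : ℕ) (x : ℝ) :
    besselJ m x = (x / 2) ^ m * besselEntire m ((x / 2) ^ 2) := by
  rw [besselJ, besselEntire, ← tsum_mul_left]
  exact tsum_congr fun j ↦ by rw [pow_add, pow_mul]; ring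

lemma besselJ_recurrence (m : ℕ) (x : ℝ) :
    2 * (m + 1) * besselJ (m + 1) x = x * (besselJ m x + besselJ (m + 2) x) := by
  simp only [besselJ_eq_besselEntire]
  rw [besselEntire_recurrence m]
  ring

lemma hasDerivAt_besselJ_zero (x : ℝ) : HasDerivAt (besselJ 0) (-besselJ 1 x) x := by
  have hsq : HasDerivAt (fun z : ℝ ↦ (z / 2) ^ 2) (x / 2) x :=
    (((hasDerivAt_id' x).div_const 2).pow 2).congr_deriv (by norm_num; ring)
  have h := (hasDerivAt_besselEntire 0 ((x / 2) ^ 2)).comp x hsq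
  refine (h.congr_deriv ?_).congr_of_eventuallyEq (.of_forall fun z ↦ ?_)
  · rw [besselJ_eq_besselEntire]; ring
  · simp [besselJ_eq_besselEntire]

lemma hasDerivAt_besselJ_succ (m : ℕ) (x : ℝ) :
    HasDerivAt (besselJ (m + 1)) ((besselJ m x - besselJ (m + 2) x) / 2) x := by
  have hhalf : HasDerivAt (fun z : ℝ ↦ z / 2) (1 / 2) x := (hasDerivAt_id' x).div_const 2
  have hsq : HasDerivAt (fun z : ℝ ↦ (z / 2) ^ 2) (x / 2) x :=
    (hhalf.pow 2).congr_deriv (by norm_num; ring)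
  have h := (hhalf.pow (m + 1)).mul ((hasDerivAt_besselEntire (m + 1) ((x / 2) ^ 2)).comp x hsq)
  refine (h.congr_deriv ?_).congr_of_eventuallyEq (.of_forall fun z ↦ ?_)
  · simp only [besselJ_eq_besselEntire, Function.comp, Pi.pow_apply]
    rw [besselEntire_recurrence m, Nat.add_sub_cancel]
    push_cast
    ring
  · simp [besselJ_eq_besselEntire]

lemma continuous_besselJ (m : ℕ) : Continuous (besselJ m) :=
  continuous_iff_continuousAt.mpr fun x ↦ by
    cases m with
    | zero => exact (hasDerivAt_besselJ_zero x).continuousAt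
    | succ m => exact (hasDerivAt_besselJ_succ m x).continuousAt

lemma besselJ_zero_zero : besselJ 0 0 = 1 := by
  rw [besselJ_eq_besselEntire, besselEntire, tsum_eq_single 0]
  · simp
  · intro j hj
    simp [hj]

lemma besselJ_succ_zero (m : ℕ) : besselJ (m + 1) 0 = 0 := by
  simp [besselJ_eq_besselEntire]

lemma intervalIntegrable_pow_mul_besselJ (p m : ℕ) (κ a b : ℝ) :
    IntervalIntegrable (fun t ↦ t ^ p * besselJ m (κ * t)) volume a b := by
  have := continuous_besselJ m
  exact Continuous.intervalIntegrable (by fun_prop) _ _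

lemma intervalIntegrable_besselJ (m : ℕ) (κ a b : ℝ) :
    IntervalIntegrable (fun t ↦ besselJ m (κ * t)) volume a b := by
  have := continuous_besselJ m
  exact Continuous.intervalIntegrable (by fun_prop) _ _

lemma hasDerivAt_besselJ_succ_const_mul (m : ℕ) (κ t : ℝ) :
    HasDerivAt (fun t ↦ besselJ (m + 1) (κ * t))
      ((besselJ m (κ * t) - besselJ (m + 2) (κ * t)) / 2 * κ) t :=
  ((hasDerivAt_besselJ_succ m (κ * t)).comp t ((hasDerivAt_id' t).const_mul κ)).congr_deriv
    (by ring)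

lemma integral_besselJ_one (κ b : ℝ) (hκ : κ ≠ 0) :
    ∫ t in (0 : ℝ)..b, besselJ 1 (κ * t) = (1 - besselJ 0 (κ * b)) / κ := by
  have hd : ∀ t ∈ Set.uIcc 0 b,
      HasDerivAt (fun t ↦ -besselJ 0 (κ * t) / κ) (besselJ 1 (κ * t)) t := fun t _ ↦
    (((hasDerivAt_besselJ_zero (κ * t)).comp t
      ((hasDerivAt_id' t).const_mul κ)).neg.div_const κ).congr_deriv (by field_simp)
  rw [intervalIntegral.integral_eq_sub_of_hasDerivAt hd (intervalIntegrable_besselJ 1 κ 0 b),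
    mul_zero, besselJ_zero_zero]
  ring

lemma integral_besselJ_add_two (m : ℕ) (κ b : ℝ) (hκ : κ ≠ 0) :
    ∫ t in (0 : ℝ)..b, besselJ (m + 2) (κ * t) =
      (∫ t in (0 : ℝ)..b, besselJ m (κ * t)) - 2 / κ * besselJ (m + 1) (κ * b) := by
  have hd : ∀ t ∈ Set.uIcc 0 b, HasDerivAt (fun t ↦ 2 / κ * besselJ (m + 1) (κ * t))
      (besselJ m (κ * t) - besselJ (m + 2) (κ * t)) t := fun t _ ↦
    ((hasDerivAt_besselJ_succ_const_mul m κ t).const_mul (2 / κ)).congr_deriv (by field_simp)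
  have hi := intervalIntegrable_besselJ m κ 0 b
  have hi' := intervalIntegrable_besselJ (m + 2) κ 0 b
  have h := intervalIntegral.integral_eq_sub_of_hasDerivAt hd (hi.sub hi')
  rw [intervalIntegral.integral_sub hi hi', mul_zero, besselJ_succ_zero] at h
  linarith

lemma integral_besselJ_odd (r : ℕ) (κ b : ℝ) (hκ : κ ≠ 0) :
    ∫ t in (0 : ℝ)..b, besselJ (2 * (r + 1) + 1) (κ * t) =
      -(1 / (2 * ((r : ℝ) + 1)) * b * besselJ (2 * (r + 1) + 1) (κ * b)) -
        (∑ j ∈ Finset.Icc 1 r,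
          ((2 * (j : ℝ) + 1) / (2 * (j : ℝ) * ((j : ℝ) + 1))) * b * besselJ (2 * j + 1) (κ * b)) -
        1 / 2 * b * besselJ 1 (κ * b) - 1 / κ * besselJ 0 (κ * b) + 1 / κ := by
  have hrec : ∀ q : ℕ, 2 / κ * besselJ (2 * q + 1 + 1) (κ * b) =
      b / (2 * ((q : ℝ) + 1)) *
        (besselJ (2 * q + 1) (κ * b) + besselJ (2 * q + 1 + 2) (κ * b)) := by
    intro q
    have h := besselJ_recurrence (2 * q + 1) (κ * b)
    push_cast at h
    have : (q : ℝ) + 1 ≠ 0 := by positivity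
    field_simp
    linarith
  induction r with
  | zero =>
    have h := hrec 0
    have h' := integral_besselJ_add_two 1 κ b hκ
    rw [integral_besselJ_one κ b hκ] at h'
    norm_num at h h' ⊢
    rw [h', h]
    ring
  | succ r ih =>
    have h := hrec (r + 1)
    have h' := integral_besselJ_add_two (2 * (r + 1) + 1) κ b hκ
    rw [ih, h] at h'
    rw [show 2 * (r + 1 + 1) + 1 = 2 * (r + 1) + 1 + 2 by ring, h',
      Finset.sum_Icc_succ_top (by omega)]
    have h1 : (r : ℝ) + 1 ≠ 0 := by positivity
    have h2 : (r : ℝ) + 1 + 1 ≠ 0 := by positivity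
    push_cast
    field_simp
    ring

lemma integral_pow_succ_mul_besselJ (p s : ℕ) (κ b : ℝ) (hκ : κ ≠ 0) :
    ∫ t in (0 : ℝ)..b, t ^ (p + 1) * besselJ (p + 1 + 1 + 2 * s) (κ * t) =
      -(1 / κ * b ^ (p + 1) * besselJ (p + 1 + 2 * s) (κ * b)) +
        2 * ((p : ℝ) + 1 + s) / κ *
          ∫ t in (0 : ℝ)..b, t ^ p * besselJ (p + 1 + 2 * s) (κ * t) := by
  rw [show p + 1 + 1 + 2 * s = p + 2 * s + 2 by ring, show p + 1 + 2 * s = p + 2 * s + 1 by ring]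
  have hd : ∀ t ∈ Set.uIcc 0 b,
      HasDerivAt (fun t ↦ t ^ (p + 1) * besselJ (p + 2 * s + 1) (κ * t))
        (2 * ((p : ℝ) + 1 + s) * (t ^ p * besselJ (p + 2 * s + 1) (κ * t)) -
          κ * (t ^ (p + 1) * besselJ (p + 2 * s + 2) (κ * t))) t := by
    intro t _
    refine ((hasDerivAt_pow (p + 1) t).mul
      (hasDerivAt_besselJ_succ_const_mul (p + 2 * s) κ t)).congr_deriv ?_
    have h := besselJ_recurrence (p + 2 * s) (κ * t)
    rw [Nat.add_sub_cancel]
    push_cast at h ⊢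
    linear_combination (-t ^ p / 2) * h
  have hi := (intervalIntegrable_pow_mul_besselJ p (p + 2 * s + 1) κ 0 b).const_mul
    (2 * ((p : ℝ) + 1 + s))
  have hi' := (intervalIntegrable_pow_mul_besselJ (p + 1) (p + 2 * s + 2) κ 0 b).const_mul κ
  have h := intervalIntegral.integral_eq_sub_of_hasDerivAt hd (hi.sub hi')
  rw [intervalIntegral.integral_sub hi hi', intervalIntegral.integral_const_mul,
    intervalIntegral.integral_const_mul, mul_zero, besselJ_succ_zero] at h
  field_simp
  linarith

lemma integral_pow_mul_besselJ (n s : ℕ) (κ b : ℝ) (hκ : κ ≠ 0) :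
    ∫ t in (0 : ℝ)..b, t ^ n * besselJ (n + 1 + 2 * s) (κ * t) =
      -(∑ j ∈ Finset.Icc 1 n,
        ((∏ l ∈ Finset.range (n - j), (2 * ((n : ℝ) + s - l) / κ)) / κ) * b ^ j *
          besselJ (j + 2 * s) (κ * b)) +
      (∏ l ∈ Finset.range n, (2 * ((n : ℝ) + s - l) / κ)) *
        ∫ t in (0 : ℝ)..b, besselJ (2 * s + 1) (κ * t) := by
  induction n with
  | zero => simp [add_comm]
  | succ n ih =>
    have hprod : ∀ k : ℕ, ∏ l ∈ Finset.range (k + 1), (2 * (((n + 1 : ℕ) : ℝ) + s - l) / κ) =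
        2 * ((n : ℝ) + 1 + s) / κ * ∏ l ∈ Finset.range k, (2 * ((n : ℝ) + s - l) / κ) := by
      intro k
      rw [Finset.prod_range_succ', mul_comm]
      congr 1
      · push_cast; ring
      · refine Finset.prod_congr rfl fun l _ ↦ ?_
        push_cast; ring
    rw [integral_pow_succ_mul_besselJ n s κ b hκ, ih, Finset.sum_Icc_succ_top (by omega), hprod n,
      Nat.sub_self, Finset.prod_range_zero, mul_add, mul_neg, Finset.mul_sum]
    have hsum : ∀ j ∈ Finset.Icc 1 n,
        2 * ((n : ℝ) + 1 + s) / κ *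
          (((∏ l ∈ Finset.range (n - j), (2 * ((n : ℝ) + s - l) / κ)) / κ) * b ^ j *
            besselJ (j + 2 * s) (κ * b)) =
        ((∏ l ∈ Finset.range (n + 1 - j), (2 * (((n + 1 : ℕ) : ℝ) + s - l) / κ)) / κ) * b ^ j *
          besselJ (j + 2 * s) (κ * b) := by
      intro j hj
      rw [Nat.succ_sub (Finset.mem_Icc.mp hj).2, hprod]
      ring
    rw [Finset.sum_congr rfl hsum]
    ring

theorem stmt_13 (n s : ℕ) (hn : 2 ≤ n) (hs : 1 ≤ s) (κ b : ℝ) (hκ : κ ≠ 0) (c : ℕ → ℝ)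
    (hc : ∀ j : ℕ, c j = ∏ l ∈ Finset.range j, (2 * ((n : ℝ) + s - l) / κ)) :
    ∫ t in (0:ℝ)..b, t ^ n * besselJ (n + 1 + 2 * s) (κ * t) =
      -(∑ j ∈ Finset.Icc 2 n, (c (n - j) / κ) * b ^ j * besselJ (j + 2 * s) (κ * b)) -
        (c (n - 1) / κ + c n / (2 * (s : ℝ))) * b * besselJ (2 * s + 1) (κ * b) -
        c n * (∑ j ∈ Finset.Icc 1 (s - 1),
          ((2 * (j : ℝ) + 1) / (2 * (j : ℝ) * ((j : ℝ) + 1))) * b * besselJ (2 * j + 1) (κ * b)) -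
        (c n / 2) * b * besselJ 1 (κ * b) - (c n / κ) * besselJ 0 (κ * b) + c n / κ := by
  obtain ⟨r, rfl⟩ := Nat.exists_eq_add_of_le' hs
  rw [integral_pow_mul_besselJ n (r + 1) κ b hκ, integral_besselJ_odd r κ b hκ]
  simp only [← hc]
  rw [← Finset.add_sum_Ioc_eq_sum_Icc (by omega : 1 ≤ n), Nat.add_sub_cancel,
    show Finset.Ioc 1 n = Finset.Icc 2 n from rfl, add_comm 1 (2 * (r + 1))]
  push_cast
  ring
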